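/- In the setup below, for every u ∈ N(v): either y'_{uv} = y*_{uv}, or the following holds: for every induced path P in the support of λ containing both u and v, every vertex adjacent to u in the subgraph induced by P is adjacent in G to every vertex of K₂^u, where K₂^u = { w ∈ N(v)∖{u} : some induced path P' in the support of λ has u as an extremity and contains w }. -/

import Mathlib

open SimpleGraph Finset
open scoped Classical

/-- A graph has a hole if some set of vertices induces a cycle of length at least 4. -/
def SimpleGraph.HasHole {V : Type*} (G : SimpleGraph V) : Prop :=
  ∃ (W : Set V) (n : ℕ), 4 ≤ n ∧ Nonempty (G.induce W ≃g SimpleGraph.cycleGraph n)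

/-- A graph is chordal if it has no hole. -/
def SimpleGraph.Chordal {V : Type*} (G : SimpleGraph V) : Prop := ¬ G.HasHole

/-- `W` induces a tree in `G`. -/
def SimpleGraph.IsInducedTree {V : Type*} (G : SimpleGraph V) (W : Finset V) : Prop :=
  (G.induce (W : Set V)).IsTree

/-- `W` induces a path in `G`. -/
def SimpleGraph.IsInducedPath {V : Type*} (G : SimpleGraph V) (W : Finset V) : Prop :=
  ∃ n : ℕ, 1 ≤ n ∧ Nonempty (G.induce (W : Set V) ≃g SimpleGraph.pathGraph n)

/-- The extended incidence vector of a vertex set `W`. -/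
noncomputable def SimpleGraph.xi {V : Type*} (G : SimpleGraph V) (W : Finset V) :
    (V → ℝ) × (Sym2 V → ℝ) :=
  (fun v => if v ∈ W then 1 else 0,
   fun e => if e ∈ G.edgeSet ∧ ∀ v ∈ e, v ∈ W then 1 else 0)

/-- `K` is a maximal clique of `G`. -/
def SimpleGraph.IsMaxCliqueF {V : Type*} (G : SimpleGraph V) (K : Finset V) : Prop :=
  G.IsClique (K : Set V) ∧ ∀ K' : Finset V, G.IsClique (K' : Set V) → K ⊆ K' → K' = K

/-- The induced tree cone `C_T(G)`. -/
noncomputable def SimpleGraph.inducedTreeCone {V : Type*} (G : SimpleGraph V) :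
    Set ((V → ℝ) × (Sym2 V → ℝ)) :=
  {p | (∀ v, 0 ≤ p.1 v) ∧ (∀ e, 0 ≤ p.2 e) ∧ (∀ e, e ∉ G.edgeSet → p.2 e = 0) ∧
    ∀ (v : V) (K : Finset V), G.IsMaxCliqueF K → v ∈ K →
      ∑ u ∈ K.erase v, p.2 s(u, v) ≤ p.1 v}

/-- The set of vertices outside `S` complete to `S`. -/
noncomputable def SimpleGraph.completeTo {V : Type*} [Fintype V] (G : SimpleGraph V)
    (S : Finset V) : Finset V :=
  Finset.univ.filter fun v => v ∉ S ∧ ∀ u ∈ S, G.Adj v u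

/-- The induced path cone `C_P(G)`. -/
noncomputable def SimpleGraph.inducedPathCone {V : Type*} [Fintype V] (G : SimpleGraph V) :
    Set ((V → ℝ) × (Sym2 V → ℝ)) :=
  {p | (∀ v, 0 ≤ p.1 v) ∧ (∀ e, 0 ≤ p.2 e) ∧ (∀ e, e ∉ G.edgeSet → p.2 e = 0) ∧
    ∀ (w : V) (K : Finset V), (K : Set V) ⊆ G.neighborSet w → G.IsClique (K : Set V) →
      ∑ u ∈ G.completeTo (insert w K), p.2 s(w, u) + 2 * ∑ u ∈ K, p.2 s(w, u) ≤ 2 * p.1 w}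

/-- The polytope `T(G)`: intersection of `C_T(G)` with the hyperplane `x(V) - y(E) = 1`. -/
noncomputable def SimpleGraph.treePolyT {V : Type*} [Fintype V] (G : SimpleGraph V) :
    Set ((V → ℝ) × (Sym2 V → ℝ)) :=
  {p ∈ G.inducedTreeCone | ∑ v : V, p.1 v - ∑ e : Sym2 V, p.2 e = 1}

/-- The polytope `P(G)`: intersection of `C_P(G)` with the hyperplane `x(V) - y(E) = 1`. -/
noncomputable def SimpleGraph.pathPolyP {V : Type*} [Fintype V] (G : SimpleGraph V) :
    Set ((V → ℝ) × (Sym2 V → ℝ)) :=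
  {p ∈ G.inducedPathCone | ∑ v : V, p.1 v - ∑ e : Sym2 V, p.2 e = 1}

/-- The induced tree polytope: convex hull of extended incidence vectors of induced trees. -/
noncomputable def SimpleGraph.inducedTreePolytope {V : Type*} (G : SimpleGraph V) :
    Set ((V → ℝ) × (Sym2 V → ℝ)) :=
  convexHull ℝ {p | ∃ W : Finset V, G.IsInducedTree W ∧ p = G.xi W}

/-- The induced path polytope: convex hull of extended incidence vectors of induced paths. -/
noncomputable def SimpleGraph.inducedPathPolytope {V : Type*} (G : SimpleGraph V) :
    Set ((V → ℝ) × (Sym2 V → ℝ)) :=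
  convexHull ℝ {p | ∃ W : Finset V, G.IsInducedPath W ∧ p = G.xi W}

/-- `p` is an extreme point of `s`: it cannot be written as the midpoint of two
distinct points of `s`. -/
def IsExtremePt {E : Type*} [AddCommGroup E] [Module ℝ E] (s : Set E) (p : E) : Prop :=
  p ∈ s ∧ ∀ q r : E, q ∈ s → r ∈ s → p = (2⁻¹ : ℝ) • (q + r) → q = r

/-- `u` is an extremity of the induced path `W` (degree at most 1 in the induced subgraph). -/
noncomputable def SimpleGraph.IsExtremity {V : Type*} (G : SimpleGraph V) (u : V)
    (W : Finset V) : Prop :=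
  u ∈ W ∧ (W.filter fun w => G.Adj u w).card ≤ 1

/-- The neighborhood of `v` as a `Finset`. -/
noncomputable def SimpleGraph.nbrF {V : Type*} [Fintype V] (G : SimpleGraph V) (v : V) :
    Finset V :=
  Finset.univ.filter fun u => G.Adj v u

/-- `K` defines an orbit of `w`. -/
noncomputable def SimpleGraph.DefinesOrbit {V : Type*} [Fintype V] (G : SimpleGraph V)
    (w : V) (K : Finset V) : Prop :=
  (K : Set V) ⊆ G.neighborSet w ∧ G.IsClique (K : Set V) ∧
    ¬ ∃ K' : Finset V, (K' : Set V) ⊆ G.neighborSet w ∧ G.IsClique (K' : Set V) ∧ K ⊂ K' ∧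
      insert w K ∪ G.completeTo (insert w K) ⊆ insert w K' ∪ G.completeTo (insert w K')

namespace SimpleGraph

variable {V : Type*} {G : SimpleGraph V}

/-- The first `n` values of `f` are distinct and induce a path of `G`, in this order. -/
def IsPathSeq (G : SimpleGraph V) (n : ℕ) (f : ℕ → V) : Prop :=
  (∀ i < n, ∀ j < n, f i = f j → i = j) ∧
    ∀ i < n, ∀ j < n, (G.Adj (f i) (f j) ↔ i + 1 = j ∨ j + 1 = i)

/-- `A` induces a path of `G` that starts at `u`. -/
def IsArm (G : SimpleGraph V) (u : V) (A : Finset V) : Prop :=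
  ∃ (n : ℕ) (f : ℕ → V), 1 ≤ n ∧ f 0 = u ∧ G.IsPathSeq n f ∧ A = (range n).image f

/-- `A` and `B` meet only in `u`, and no edge joins `A \ {u}` to `B \ {u}`. -/
def SeparatedAt (G : SimpleGraph V) (u : V) (A B : Finset V) : Prop :=
  ∀ a ∈ A, a ≠ u → ∀ b ∈ B, b ≠ u → a ≠ b ∧ ¬ G.Adj a b

theorem SeparatedAt.symm {u : V} {A B : Finset V} (h : G.SeparatedAt u A B) :
    G.SeparatedAt u B A :=
  fun b hb hbu a ha hau => ⟨(h a ha hau b hb hbu).1.symm, fun h' => (h a ha hau b hb hbu).2 h'.symm⟩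

theorem nonempty_induce_iso {n : ℕ} {H : SimpleGraph (Fin n)} {f : ℕ → V}
    (hinj : ∀ i < n, ∀ j < n, f i = f j → i = j)
    (hadj : ∀ i j : Fin n, G.Adj (f i) (f j) ↔ H.Adj i j) {W : Set V}
    (hW : ∀ x, x ∈ W ↔ ∃ i < n, f i = x) : Nonempty (G.induce W ≃g H) := by
  let g : Fin n → W := fun i => ⟨f i, (hW _).2 ⟨i, i.2, rfl⟩⟩
  have hg : Function.Bijective g := by
    constructor
    · intro i j hij
      exact Fin.ext (hinj i i.2 j j.2 (congrArg Subtype.val hij))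
    · rintro ⟨x, hx⟩
      obtain ⟨i, hi, rfl⟩ := (hW x).1 hx
      exact ⟨⟨i, hi⟩, rfl⟩
  exact ⟨(⟨Equiv.ofBijective g hg, fun {i j} => hadj i j⟩ : H ≃g G.induce W).symm⟩

theorem IsPathSeq.isInducedPath {n : ℕ} {f : ℕ → V} (hn : 1 ≤ n) (h : G.IsPathSeq n f) :
    G.IsInducedPath ((range n).image f) := by
  refine ⟨n, hn, nonempty_induce_iso h.1 (fun i j => ?_) (fun x => by simp)⟩
  rw [h.2 i i.2 j j.2, pathGraph_adj]

theorem IsInducedPath.exists_isPathSeq {W : Finset V} (h : G.IsInducedPath W) :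
    ∃ (n : ℕ) (f : ℕ → V), G.IsPathSeq n f ∧ W = (range n).image f := by
  obtain ⟨n, hn, ⟨e⟩⟩ := h
  have hf : ∀ i (hi : i < n), (if h : i < n then (e.symm ⟨i, h⟩).1
      else (e.symm ⟨0, hn⟩).1) = (e.symm ⟨i, hi⟩).1 := fun i hi => dif_pos hi
  refine ⟨n, fun i => if h : i < n then (e.symm ⟨i, h⟩).1 else (e.symm ⟨0, hn⟩).1,
    ⟨?_, ?_⟩, ?_⟩
  · intro i hi j hj hij
    simp only [hf i hi, hf j hj] at hij
    simpa using e.symm.injective (Subtype.ext hij)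
  · intro i hi j hj
    simp only [hf i hi, hf j hj]
    have := e.symm.map_rel_iff (a := ⟨i, hi⟩) (b := ⟨j, hj⟩)
    rw [pathGraph_adj] at this
    exact this
  · ext x
    simp only [mem_image, mem_range]
    constructor
    · intro hx
      refine ⟨e ⟨x, hx⟩, (e ⟨x, hx⟩).2, ?_⟩
      rw [hf _ (e ⟨x, hx⟩).2]
      simp
    · rintro ⟨i, hi, rfl⟩
      rw [hf i hi]
      exact (e.symm ⟨i, hi⟩).2

theorem IsArm.mem {u : V} {A : Finset V} (h : G.IsArm u A) : u ∈ A := by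
  obtain ⟨n, f, hn, rfl, -, rfl⟩ := h
  exact mem_image_of_mem f (mem_range.2 hn)

theorem IsArm.isInducedPath {u : V} {A : Finset V} (h : G.IsArm u A) : G.IsInducedPath A := by
  obtain ⟨n, f, hn, rfl, hf, rfl⟩ := h
  exact hf.isInducedPath hn

theorem isArm_pair {u v : V} (h : G.Adj u v) : G.IsArm u {u, v} := by
  refine ⟨2, fun i => if i = 0 then u else v, by simp, by simp, ⟨?_, ?_⟩, ?_⟩
  · intro i hi j hj hij
    interval_cases i <;> interval_cases j <;> simp_all [h.ne, h.ne']
  · intro i hi j hj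
    interval_cases i <;> interval_cases j <;> simp_all [h.symm]
  · simp [range_add_one, pair_comm]

theorem IsArm.union_isInducedPath {u : V} {A B : Finset V} (hA : G.IsArm u A) (hB : G.IsArm u B)
    (hAB : G.SeparatedAt u A B) : G.IsInducedPath (A ∪ B) := by
  obtain ⟨n, f, hn, rfl, hf, rfl⟩ := hA
  obtain ⟨m, g, hm, hg0, hg, rfl⟩ := hB
  have key : ∀ i < n, i ≠ 0 → ∀ j < m, j ≠ 0 → f i ≠ g j ∧ ¬ G.Adj (f i) (g j) := by
    intro i hi hi0 j hj hj0
    exact hAB _ (mem_image_of_mem f (by simpa using hi))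
      (fun h => hi0 (hf.1 i hi 0 hn h)) _ (mem_image_of_mem g (by simpa using hj))
      (fun h => hj0 (hg.1 j hj 0 hm (h.trans hg0.symm)))
  have hset : (range n).image f ∪ (range m).image g =
      (range (n + m - 1)).image (fun i => if i < n then f (n - 1 - i) else g (i - (n - 1))) := by
    ext x
    simp only [mem_union, mem_image, mem_range]
    constructor
    · rintro (⟨i, hi, rfl⟩ | ⟨i, hi, rfl⟩)
      · exact ⟨n - 1 - i, by omega, by rw [if_pos (by omega)]; congr 1; omega⟩
      · rcases Nat.eq_zero_or_pos i with rfl | hi0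
        · exact ⟨n - 1, by omega, by rw [if_pos (by omega), hg0]; congr 1; omega⟩
        · exact ⟨n - 1 + i, by omega, by rw [if_neg (by omega)]; congr 1; omega⟩
    · rintro ⟨i, hi, rfl⟩
      split_ifs with h
      · exact Or.inl ⟨_, by omega, rfl⟩
      · exact Or.inr ⟨_, by omega, rfl⟩
  have hcross : ∀ i < n, ∀ j < n + m - 1, ¬ j < n → f (n - 1 - i) ≠ g (j - (n - 1)) ∧
      (G.Adj (f (n - 1 - i)) (g (j - (n - 1))) ↔ i + 1 = j) := by
    intro i hi j hj hjn
    by_cases hi' : n - 1 - i = 0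
    · rw [hi', ← hg0]
      refine ⟨fun h => ?_, ?_⟩
      · have := hg.1 0 hm _ (by omega) h
        omega
      · rw [hg.2 0 hm _ (by omega)]
        omega
    · obtain ⟨h1, h2⟩ := key (n - 1 - i) (by omega) hi' (j - (n - 1)) (by omega) (by omega)
      exact ⟨h1, iff_of_false h2 (by omega)⟩
  rw [hset]
  refine IsPathSeq.isInducedPath (by omega) ⟨?_, ?_⟩
  · intro i hi j hj hij
    simp only at hij
    split_ifs at hij with h1 h2 h2
    · have := hf.1 _ (by omega) _ (by omega) hij
      omega
    · exact absurd hij (hcross i h1 j hj h2).1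
    · exact absurd hij.symm (hcross j h2 i hi h1).1
    · have := hg.1 _ (by omega) _ (by omega) hij
      omega
  · intro i hi j hj
    simp only
    split_ifs with h1 h2 h2
    · rw [hf.2 _ (by omega) _ (by omega)]
      omega
    · rw [(hcross i h1 j hj h2).2]
      omega
    · rw [G.adj_comm, (hcross j h2 i hi h1).2]
      omega
    · rw [hg.2 _ (by omega) _ (by omega)]
      omega

theorem IsInducedPath.exists_isArm {u : V} {W : Finset V} (h : G.IsInducedPath W) (hu : u ∈ W) :
    ∃ A B, G.IsArm u A ∧ G.IsArm u B ∧ W = A ∪ B ∧ G.SeparatedAt u A B := by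
  obtain ⟨n, f, hf, rfl⟩ := h.exists_isPathSeq
  obtain ⟨k, hk, rfl⟩ := mem_image.1 hu
  rw [mem_range] at hk
  refine ⟨(range (k + 1)).image (fun i => f (k - i)), (range (n - k)).image (fun i => f (k + i)),
    ⟨k + 1, _, by omega, rfl, ⟨?_, ?_⟩, rfl⟩, ⟨n - k, _, by omega, rfl, ⟨?_, ?_⟩, rfl⟩, ?_, ?_⟩
  · intro i hi j hj hij
    have := hf.1 _ (by omega) _ (by omega) hij
    omega
  · intro i hi j hj
    rw [hf.2 _ (by omega) _ (by omega)]
    omega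
  · intro i hi j hj hij
    have := hf.1 _ (by omega) _ (by omega) hij
    omega
  · intro i hi j hj
    rw [hf.2 _ (by omega) _ (by omega)]
    omega
  · ext x
    simp only [mem_union, mem_image, mem_range]
    constructor
    · rintro ⟨i, hi, rfl⟩
      rcases le_total i k with h | h
      · exact Or.inl ⟨k - i, by omega, by congr 1; omega⟩
      · exact Or.inr ⟨i - k, by omega, by congr 1; omega⟩
    · rintro (⟨i, hi, rfl⟩ | ⟨i, hi, rfl⟩)
      · exact ⟨_, by omega, rfl⟩
      · exact ⟨_, by omega, rfl⟩
  · intro a ha hau b hb hbu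
    simp only [mem_image, mem_range] at ha hb
    obtain ⟨i, hi, rfl⟩ := ha
    obtain ⟨j, hj, rfl⟩ := hb
    have hi0 : k - i ≠ k := fun h => hau (by rw [h])
    have hj0 : k + j ≠ k := fun h => hbu (by rw [h])
    refine ⟨fun h => ?_, fun h => ?_⟩
    · have := hf.1 _ (by omega) _ (by omega) h
      omega
    · rw [hf.2 _ (by omega) _ (by omega)] at h
      omega

/-- In a chordal graph, arms whose first vertices are distinct and nonadjacent are separated. -/
theorem Chordal.separatedAt (hG : G.Chordal) {u z w : V} {A B : Finset V} (hA : G.IsArm u A)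
    (hB : G.IsArm u B) (hz : z ∈ A) (hw : w ∈ B) (huz : G.Adj u z) (huw : G.Adj u w)
    (hzw : z ≠ w) (hnzw : ¬ G.Adj z w) : G.SeparatedAt u A B := by
  obtain ⟨n, f, hn, rfl, hf, rfl⟩ := hA
  obtain ⟨m, g, hm, hg0, hg, rfl⟩ := hB
  have hz1 : z = f 1 := by
    obtain ⟨i, hi, rfl⟩ := mem_image.1 hz
    rw [mem_range] at hi
    rw [hf.2 0 hn i hi] at huz
    congr 1
    omega
  have hw1 : w = g 1 := by
    obtain ⟨i, hi, rfl⟩ := mem_image.1 hw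
    rw [mem_range] at hi
    rw [← hg0, hg.2 0 hm i hi] at huw
    congr 1
    omega
  subst hz1 hw1
  have key : ∀ s i j, i + j = s → 1 ≤ i → i < n → 1 ≤ j → j < m →
      f i ≠ g j ∧ ¬ G.Adj (f i) (g j) := by
    intro s
    induction s using Nat.strong_induction_on with
    | _ s ih =>
    intro i j hs hi hin hj hjm
    by_cases h11 : i = 1 ∧ j = 1
    · rw [h11.1, h11.2]
      exact ⟨hzw, hnzw⟩
    have hne : f i ≠ g j := by
      intro heq
      by_cases hi1 : i = 1
      · refine (ih (i + (j - 1)) (by omega) i (j - 1) rfl hi hin (by omega) (by omega)).2 ?_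
        rw [heq, hg.2 _ hjm _ (by omega)]
        omega
      · refine (ih (i - 1 + j) (by omega) (i - 1) j rfl (by omega) (by omega) hj hjm).2 ?_
        rw [← heq, hf.2 _ (by omega) _ hin]
        omega
    refine ⟨hne, fun hadj => hG ?_⟩
    have hcross : ∀ a, 1 ≤ a → a ≤ i → ∀ b, 1 ≤ b → b ≤ j →
        f a ≠ g b ∧ (G.Adj (f a) (g b) ↔ a = i ∧ b = j) := by
      intro a ha hai b hb hbj
      by_cases hab : a = i ∧ b = j
      · rw [hab.1, hab.2]
        exact ⟨hne, by simpa using hadj⟩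
      · obtain ⟨h1, h2⟩ := ih (a + b) (by omega) a b rfl ha (by omega) hb (by omega)
        exact ⟨h1, iff_of_false h2 hab⟩
    have hcross' : ∀ a ≤ i, ∀ b, 1 ≤ b → b ≤ j →
        f a ≠ g b ∧ (G.Adj (f a) (g b) ↔ a = i ∧ b = j ∨ a = 0 ∧ b = 1) := by
      intro a hai b hb hbj
      rcases Nat.eq_zero_or_pos a with rfl | ha
      · rw [← hg0]
        refine ⟨fun h => ?_, ?_⟩
        · have := hg.1 0 hm b (by omega) h
          omega
        · rw [hg.2 0 hm b (by omega)]
          omega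
      · refine ⟨(hcross a ha hai b hb hbj).1, ?_⟩
        rw [(hcross a ha hai b hb hbj).2]
        omega
    refine ⟨{x | ∃ k < i + j + 1, (if k ≤ i then f k else g (i + j + 1 - k)) = x}, i + j + 1,
      by omega, nonempty_induce_iso (f := fun k => if k ≤ i then f k else g (i + j + 1 - k))
        ?_ ?_ (fun x => Iff.rfl)⟩
    · intro a ha b hb hab
      split_ifs at hab with h1 h2 h2
      · exact hf.1 _ (by omega) _ (by omega) hab
      · exact absurd hab (hcross' a h1 _ (by omega) (by omega)).1
      · exact absurd hab.symm (hcross' b h2 _ (by omega) (by omega)).1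
      · have := hg.1 _ (by omega) _ (by omega) hab
        omega
    · rintro ⟨a, ha⟩ ⟨b, hb⟩
      have hcyc : (cycleGraph (i + j + 1)).Adj ⟨a, ha⟩ ⟨b, hb⟩ ↔
          (a + 1 = b ∨ b + 1 = a) ∨ (a = 0 ∧ b = i + j) ∨ (b = 0 ∧ a = i + j) := by
        rw [cycleGraph_adj', Fin.val_sub, Fin.val_sub]
        rcases lt_trichotomy a b with h | rfl | h
        · rw [show i + j + 1 - b + a = i + j + 1 - (b - a) by omega,
            show i + j + 1 - a + b = b - a + (i + j + 1) by omega, Nat.add_mod_right,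
            Nat.mod_eq_of_lt (by omega), Nat.mod_eq_of_lt (by omega)]
          omega
        · rw [Nat.sub_add_cancel ha.le, Nat.mod_self]
          omega
        · rw [show i + j + 1 - a + b = i + j + 1 - (a - b) by omega,
            show i + j + 1 - b + a = a - b + (i + j + 1) by omega, Nat.add_mod_right,
            Nat.mod_eq_of_lt (by omega), Nat.mod_eq_of_lt (by omega)]
          omega
      rw [hcyc]
      change G.Adj (if a ≤ i then f a else g (i + j + 1 - a))
        (if b ≤ i then f b else g (i + j + 1 - b)) ↔ _
      split_ifs with h1 h2 h2
      · rw [hf.2 _ (by omega) _ (by omega)]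
        omega
      · rw [(hcross' a h1 _ (by omega) (by omega)).2]
        omega
      · rw [G.adj_comm, (hcross' b h2 _ (by omega) (by omega)).2]
        omega
      · rw [hg.2 _ (by omega) _ (by omega)]
        omega
  intro a ha hau b hb hbu
  obtain ⟨i, hi, rfl⟩ := mem_image.1 ha
  obtain ⟨j, hj, rfl⟩ := mem_image.1 hb
  rw [mem_range] at hi hj
  refine key _ i j rfl (Nat.one_le_iff_ne_zero.2 ?_) hi (Nat.one_le_iff_ne_zero.2 ?_) hj
  · rintro rfl
    exact hau rfl
  · rintro rfl
    exact hbu hg0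

theorem xi_fst_apply (W : Finset V) (x : V) : (G.xi W).1 x = if x ∈ W then 1 else 0 := rfl

theorem xi_snd_apply (W : Finset V) (a b : V) :
    (G.xi W).2 s(a, b) = if G.Adj a b ∧ a ∈ W ∧ b ∈ W then 1 else 0 := by
  simp [xi]

theorem xi_singleton_snd (u : V) (e : Sym2 V) : (G.xi {u}).2 e = 0 := by
  induction e with | _ a b
  rw [xi_snd_apply, if_neg]
  rintro ⟨h, ha, hb⟩
  exact h.ne ((mem_singleton.1 ha).trans (mem_singleton.1 hb).symm)

theorem xi_pair_snd {u v : V} (h : G.Adj u v) (e : Sym2 V) :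
    (G.xi {u, v}).2 e = if e = s(u, v) then 1 else 0 := by
  induction e with | _ a b
  rw [xi_snd_apply]
  refine if_congr ?_ rfl rfl
  simp only [mem_insert, mem_singleton, Sym2.eq_iff]
  constructor
  · rintro ⟨hab, rfl | rfl, rfl | rfl⟩
    · exact absurd rfl hab.ne
    · exact Or.inl ⟨rfl, rfl⟩
    · exact Or.inr ⟨rfl, rfl⟩
    · exact absurd rfl hab.ne
  · rintro (⟨rfl, rfl⟩ | ⟨rfl, rfl⟩)
    · exact ⟨h, Or.inl rfl, Or.inr rfl⟩
    · exact ⟨h.symm, Or.inr rfl, Or.inl rfl⟩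

theorem xi_union {u : V} {A B : Finset V} (hA : u ∈ A) (hB : u ∈ B)
    (h : G.SeparatedAt u A B) : G.xi (A ∪ B) = G.xi A + G.xi B - G.xi {u} := by
  refine Prod.ext (funext fun x => ?_) (funext fun e => ?_)
  · simp only [Prod.fst_sub, Prod.fst_add, Pi.sub_apply, Pi.add_apply, xi_fst_apply, mem_union,
      mem_singleton]
    by_cases hx : x = u
    · subst hx
      simp [hA, hB]
    · by_cases hxA : x ∈ A <;> by_cases hxB : x ∈ B <;> simp [hx, hxA, hxB]
      exact (h x hxA hx x hxB hx).1 rfl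
  · simp only [Prod.snd_sub, Prod.snd_add, Pi.sub_apply, Pi.add_apply, xi_singleton_snd]
    induction e with | _ a b
    simp only [xi_snd_apply, mem_union]
    by_cases hab : G.Adj a b
    · have h1 : a ∈ A → b ∈ B → a = u ∨ b = u := by
        intro ha hb
        by_contra! hn
        exact (h a ha hn.1 b hb hn.2).2 hab
      have h2 : b ∈ A → a ∈ B → a = u ∨ b = u := by
        intro hb ha
        by_contra! hn
        exact (h b hb hn.2 a ha hn.1).2 hab.symm
      have h3 : a ∈ A → a ∈ B → a = u := by
        intro ha hb
        by_contra hn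
        exact (h a ha hn a hb hn).1 rfl
      have h4 : b ∈ A → b ∈ B → b = u := by
        intro ha hb
        by_contra hn
        exact (h b ha hn b hb hn).1 rfl
      have h5 := hab.ne
      by_cases haA : a ∈ A <;> by_cases haB : a ∈ B <;> by_cases hbA : b ∈ A <;>
        by_cases hbB : b ∈ B <;> simp_all <;> grind
    · simp [hab]

/-- Replacing the members of `S` by those of `T` in a combination with coefficients `lam`. -/
theorem sum_exchange {E : Type*} [Fintype V] [AddCommGroup E] [Module ℝ E] (lam : Finset V → ℕ)
    (S T : Multiset (Finset V)) (hS : ∀ X, S.count X ≤ lam X) (F : Finset V → E) :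
    ∑ X : Finset V, ((lam X - S.count X + T.count X : ℕ) : ℝ) • F X =
      ∑ X : Finset V, (lam X : ℝ) • F X - (S.map F).sum + (T.map F).sum := by
  have key : ∀ M : Multiset (Finset V),
      (M.map F).sum = ∑ X : Finset V, (M.count X : ℝ) • F X := by
    intro M
    rw [Finset.sum_multiset_map_count]
    simp only [Nat.cast_smul_eq_nsmul]
    refine Finset.sum_subset (subset_univ _) fun X _ hX => ?_
    rw [Multiset.mem_toFinset] at hX
    simp [Multiset.count_eq_zero_of_notMem hX]
  rw [key, key, ← Finset.sum_sub_distrib, ← Finset.sum_add_distrib]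
  refine Finset.sum_congr rfl fun X _ => ?_
  rw [Nat.cast_add, Nat.cast_sub (hS X), add_smul, sub_smul]

theorem sum_smul_xi_fst [Fintype V] (lam : Finset V → ℕ) (x : V) :
    (∑ W : Finset V, (lam W : ℝ) • G.xi W).1 x = ∑ W : Finset V, (lam W : ℝ) * (G.xi W).1 x := by
  simp [Prod.fst_sum]

theorem sum_smul_xi_snd [Fintype V] (lam : Finset V → ℕ) (e : Sym2 V) :
    (∑ W : Finset V, (lam W : ℝ) • G.xi W).2 e = ∑ W : Finset V, (lam W : ℝ) * (G.xi W).2 e := by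
  simp [Prod.snd_sum]

theorem IsInducedPath.exists_adj {W : Finset V} (h : G.IsInducedPath W) {v : V} (hv : v ∈ W)
    (hW : W ≠ {v}) : ∃ t ∈ W, G.Adj t v := by
  obtain ⟨n, f, hf, rfl⟩ := h.exists_isPathSeq
  obtain ⟨k, hk, rfl⟩ := mem_image.1 hv
  rw [mem_range] at hk
  by_cases hk0 : k = 0
  · subst hk0
    by_cases hn : n = 1
    · subst hn
      simp at hW
    · exact ⟨f 1, mem_image_of_mem f (mem_range.2 (by omega)),
        (hf.2 1 (by omega) 0 hk).2 (by omega)⟩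
  · exact ⟨f (k - 1), mem_image_of_mem f (mem_range.2 (by omega)),
        (hf.2 _ (by omega) k hk).2 (by omega)⟩

/-- An arm at `u` that contains a neighbor `v` of `u` is `{u, v}` if `v` is simplicial. -/
theorem IsArm.eq_pair {u v : V} {A : Finset V} (hA : G.IsArm u A) (huv : G.Adj u v) (hv : v ∈ A)
    (hsimp : G.IsClique (G.neighborSet v)) : A = {u, v} := by
  obtain ⟨n, f, hn, rfl, hf, rfl⟩ := hA
  obtain ⟨i, hi, rfl⟩ := mem_image.1 hv
  rw [mem_range] at hi
  rw [hf.2 0 hn i hi] at huv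
  obtain rfl : i = 1 := by omega
  have hn2 : n = 2 := by
    by_contra hne
    have h02 : f 0 ≠ f 2 := fun h => by
      have := hf.1 0 hn 2 (by omega) h
      omega
    have := hsimp ((hf.2 1 hi 0 hn).2 (by omega)) ((hf.2 1 hi 2 (by omega)).2 (by omega)) h02
    rw [hf.2 0 hn 2 (by omega)] at this
    omega
  subst hn2
  simp [range_add_one, pair_comm]

theorem IsArm.exists_adj {u : V} {A : Finset V} (hA : G.IsArm u A) (h : A ≠ {u}) :
    ∃ t ∈ A, G.Adj u t := by
  obtain ⟨t, ht, hadj⟩ := hA.isInducedPath.exists_adj hA.mem h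
  exact ⟨t, ht, hadj.symm⟩

theorem IsExtremity.eq_of_adj {u s t : V} {P : Finset V} (h : G.IsExtremity u P) (hs : s ∈ P)
    (ht : t ∈ P) (hus : G.Adj u s) (hut : G.Adj u t) : s = t :=
  card_le_one.1 h.2 s (mem_filter.2 ⟨hs, hus⟩) t (mem_filter.2 ⟨ht, hut⟩)

/-- An induced path is an arm at each of its extremities. -/
theorem IsInducedPath.isArm {u : V} {P : Finset V} (hP : G.IsInducedPath P)
    (hu : G.IsExtremity u P) : G.IsArm u P := by
  obtain ⟨A, B, hA, hB, rfl, hAB⟩ := hP.exists_isArm hu.1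
  by_cases hA1 : A = {u}
  · subst hA1
    rwa [union_eq_right.2 (singleton_subset_iff.2 hB.mem)]
  by_cases hB1 : B = {u}
  · subst hB1
    rwa [union_eq_left.2 (singleton_subset_iff.2 hA.mem)]
  obtain ⟨s, hs, hus⟩ := hA.exists_adj hA1
  obtain ⟨t, ht, hut⟩ := hB.exists_adj hB1
  exact absurd (hu.eq_of_adj (mem_union_left _ hs) (mem_union_right _ ht) hus hut)
    (hAB s hs hus.ne' t ht hut.ne').1

section Cone

variable [Fintype V] {p : (V → ℝ) × (Sym2 V → ℝ)}

theorem mem_nbrF {v t : V} : t ∈ G.nbrF v ↔ G.Adj v t := by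
  simp [nbrF]

theorem sum_le_of_mem_inducedPathCone (hp : p ∈ G.inducedPathCone) {w : V} {K : Finset V}
    (hK : (K : Set V) ⊆ G.neighborSet w) (hc : G.IsClique (K : Set V)) :
    ∑ t ∈ K, p.2 s(w, t) ≤ p.1 w := by
  have h1 := hp.2.2.2 w K hK hc
  have h2 : 0 ≤ ∑ t ∈ G.completeTo (insert w K), p.2 s(w, t) :=
    sum_nonneg fun t _ => hp.2.1 _
  linarith

/-- Copies of the trivial path at a simplicial vertex `v` may be discarded, and afterwards the
vertex inequality at `v` follows from the edge inequalities. -/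
theorem exists_le_of_edge_le (hp : p ∈ G.inducedPathCone) {v : V}
    (hsimp : G.IsClique (G.neighborSet v)) (mu : Finset V → ℕ)
    (hmu : ∀ W, mu W ≠ 0 → G.IsInducedPath W)
    (hle : ∀ e, (∑ W : Finset V, (mu W : ℝ) • G.xi W).2 e ≤ p.2 e) :
    ∃ nu : Finset V → ℕ, (∀ W, nu W ≠ 0 → G.IsInducedPath W) ∧
      (∑ W : Finset V, (nu W : ℝ) • G.xi W).2 = (∑ W : Finset V, (mu W : ℝ) • G.xi W).2 ∧
      (∀ w ≠ v, (∑ W : Finset V, (nu W : ℝ) • G.xi W).1 w =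
        (∑ W : Finset V, (mu W : ℝ) • G.xi W).1 w) ∧
      (∑ W : Finset V, (nu W : ℝ) • G.xi W).1 v ≤ p.1 v := by
  let nu : Finset V → ℕ := fun W => if W = {v} then 0 else mu W
  have hsnd : (∑ W : Finset V, (nu W : ℝ) • G.xi W).2 =
      (∑ W : Finset V, (mu W : ℝ) • G.xi W).2 := by
    funext e
    rw [sum_smul_xi_snd, sum_smul_xi_snd]
    refine sum_congr rfl fun W _ => ?_
    by_cases hW : W = {v}
    · rw [hW, xi_singleton_snd, mul_zero, mul_zero]
    · simp [nu, hW]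
  have hnu : ∀ W, nu W ≠ 0 → G.IsInducedPath W := by
    intro W hW
    refine hmu W fun h => hW ?_
    simp [nu, h]
  refine ⟨nu, hnu, hsnd, ?_, ?_⟩
  · intro w hw
    rw [sum_smul_xi_fst, sum_smul_xi_fst]
    refine sum_congr rfl fun W _ => ?_
    by_cases hW : W = {v}
    · rw [hW, xi_fst_apply, if_neg (by simpa using hw), mul_zero, mul_zero]
    · simp [nu, hW]
  · have hK : ((G.nbrF v : Finset V) : Set V) = G.neighborSet v := by
      ext t
      simp [mem_nbrF]
    calc (∑ W : Finset V, (nu W : ℝ) • G.xi W).1 v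
        = ∑ W : Finset V, (nu W : ℝ) * (G.xi W).1 v := sum_smul_xi_fst _ _
      _ ≤ ∑ W : Finset V, (nu W : ℝ) * ∑ t ∈ G.nbrF v, (G.xi W).2 s(v, t) := by
          refine sum_le_sum fun W _ => ?_
          by_cases hW0 : nu W = 0
          · simp [hW0]
          refine mul_le_mul_of_nonneg_left ?_ (Nat.cast_nonneg _)
          have hnn : ∀ t ∈ G.nbrF v, 0 ≤ (G.xi W).2 s(v, t) := by
            intro t _
            rw [xi_snd_apply]
            split_ifs <;> simp
          by_cases hv : v ∈ W
          · obtain ⟨t, ht, htv⟩ := (hnu W hW0).exists_adj hv (fun h => hW0 (by simp [nu, h]))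
            refine le_trans (le_of_eq ?_) (single_le_sum hnn (mem_nbrF.2 htv.symm))
            rw [xi_fst_apply, xi_snd_apply, if_pos hv, if_pos ⟨htv.symm, hv, ht⟩]
          · rw [xi_fst_apply, if_neg hv]
            exact sum_nonneg hnn
      _ = ∑ t ∈ G.nbrF v, (∑ W : Finset V, (nu W : ℝ) • G.xi W).2 s(v, t) := by
          simp only [mul_sum, sum_smul_xi_snd]
          exact sum_comm
      _ ≤ ∑ t ∈ G.nbrF v, p.2 s(v, t) := by
          rw [hsnd]
          exact sum_le_sum fun t _ => hle _
      _ ≤ p.1 v := sum_le_of_mem_inducedPathCone hp hK.le (hK ▸ hsimp)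

/-- If an edge at `u` in a clique is not saturated, some path of the combination visits `u` and
avoids that clique. -/
theorem exists_path_avoiding (hp : p ∈ G.inducedPathCone) {u v : V} {K : Finset V}
    (hK : (K : Set V) ⊆ G.neighborSet u) (hc : G.IsClique (K : Set V)) (hv : v ∈ K)
    (lam : Finset V → ℕ)
    (hle : ∀ e, (∑ W : Finset V, (lam W : ℝ) • G.xi W).2 e ≤ p.2 e)
    (hlt : (∑ W : Finset V, (lam W : ℝ) • G.xi W).2 s(u, v) < p.2 s(u, v))
    (heq : (∑ W : Finset V, (lam W : ℝ) • G.xi W).1 u = p.1 u) :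
    ∃ W, lam W ≠ 0 ∧ u ∈ W ∧ ∀ t ∈ K, t ∉ W := by
  by_contra! hcon
  have h1 : ∑ t ∈ K, (∑ W : Finset V, (lam W : ℝ) • G.xi W).2 s(u, t) < p.1 u :=
    (sum_lt_sum (fun t _ => hle s(u, t)) ⟨v, hv, hlt⟩).trans_le
      (sum_le_of_mem_inducedPathCone hp hK hc)
  rw [← heq, sum_smul_xi_fst] at h1
  refine absurd h1 (not_lt.2 ?_)
  simp only [sum_smul_xi_snd]
  rw [sum_comm]
  refine sum_le_sum fun W _ => ?_
  rw [← mul_sum]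
  by_cases hW0 : lam W = 0
  · simp [hW0]
  refine mul_le_mul_of_nonneg_left ?_ (Nat.cast_nonneg _)
  have hnn : ∀ t ∈ K, 0 ≤ (G.xi W).2 s(u, t) := by
    intro t _
    rw [xi_snd_apply]
    split_ifs <;> simp
  by_cases hu : u ∈ W
  · obtain ⟨t, ht, htW⟩ := hcon W hW0 hu
    refine le_trans (le_of_eq ?_) (single_le_sum hnn ht)
    rw [xi_fst_apply, xi_snd_apply, if_pos hu, if_pos ⟨hK ht, hu, htW⟩]
  · rw [xi_fst_apply, if_neg hu]
    exact sum_nonneg hnn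

end Cone

end SimpleGraph

/-- for every `u ∈ N(v)`, either `y'_{uv} = y*_{uv}` or the neighbors of
`u` on paths of the support containing `u` and `v` are complete to `K₂ᵘ`. -/
theorem lem_psiuv_complete
    {V : Type*} [Fintype V] (G : SimpleGraph V) (hG : G.Chordal)
    (v : V) (hsimp : G.IsClique (G.neighborSet v))
    (ps : (V → ℝ) × (Sym2 V → ℝ)) (hps : ps ∈ G.inducedPathCone)
    (hintx : ∀ w, ∃ n : ℤ, ps.1 w = n) (hinty : ∀ e, ∃ n : ℤ, ps.2 e = n)
    (lam : Finset V → ℕ) (hlam : ∀ W, lam W ≠ 0 → G.IsInducedPath W)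
    (p' : (V → ℝ) × (Sym2 V → ℝ)) (hp' : p' = ∑ W : Finset V, (lam W : ℝ) • G.xi W)
    (hle1 : ∀ w, p'.1 w ≤ ps.1 w) (hle2 : ∀ e, p'.2 e ≤ ps.2 e)
    (heq1 : ∀ w, w ≠ v → p'.1 w = ps.1 w)
    (heq2 : ∀ e : Sym2 V, v ∉ e → p'.2 e = ps.2 e)
    (hmin : ∀ (mu : Finset V → ℕ) (q : (V → ℝ) × (Sym2 V → ℝ)),
      q = ∑ W : Finset V, (mu W : ℝ) • G.xi W →
      (∀ W, mu W ≠ 0 → G.IsInducedPath W) →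
      (∀ w, q.1 w ≤ ps.1 w) → (∀ e, q.2 e ≤ ps.2 e) →
      (∀ w, w ≠ v → q.1 w = ps.1 w) →
      (∀ e : Sym2 V, v ∉ e → q.2 e = ps.2 e) →
      ∑ u ∈ G.nbrF v, (ps.2 s(u, v) - p'.2 s(u, v)) ≤
        ∑ u ∈ G.nbrF v, (ps.2 s(u, v) - q.2 s(u, v))) :
    ∀ u ∈ G.nbrF v,
      p'.2 s(u, v) = ps.2 s(u, v) ∨
      ∀ W : Finset V, lam W ≠ 0 → u ∈ W → v ∈ W →
        ∀ z ∈ W, G.Adj u z →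
          ∀ w : V, G.Adj v w → w ≠ u →
            (∃ P' : Finset V, lam P' ≠ 0 ∧ G.IsExtremity u P' ∧ w ∈ P') →
            G.Adj z w := by
  subst hp'
  intro u hu
  rw [mem_nbrF] at hu
  by_contra! hcon
  obtain ⟨hne, W, hW, huW, hvW, z, hzW, huz, w, hvw, hwu, ⟨P, hP, huP, hwP⟩, hnzw⟩ := hcon
  have huw : G.Adj u w := hsimp hu hvw hwu.symm
  have hvz : z ≠ v := fun h => hnzw (h ▸ hvw)
  have hlt : (∑ W : Finset V, (lam W : ℝ) • G.xi W).2 s(u, v) < ps.2 s(u, v) :=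
    lt_of_le_of_ne (hle2 _) hne
  -- A path `Q` through `u` that avoids all other vertices of the closed neighborhood of `v`.
  obtain ⟨Q, hQ, huQ, hQK⟩ := exists_path_avoiding (K := insert v ((G.nbrF v).erase u)) hps
    (by
      intro t ht
      rcases mem_insert.1 ht with rfl | ht
      · exact hu.symm
      · exact hsimp hu (mem_nbrF.1 (mem_of_mem_erase ht)) (ne_of_mem_erase ht).symm)
    (by
      rw [coe_insert]
      refine (hsimp.subset fun t ht => mem_nbrF.1 (mem_of_mem_erase ht)).insert fun t ht _ =>
        mem_nbrF.1 (mem_of_mem_erase ht))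
    (mem_insert_self _ _) lam hle2 hlt (heq1 u hu.ne')
  have hvQ : v ∉ Q := hQK v (mem_insert_self _ _)
  have hQv : ∀ t ∈ Q, t ≠ u → ¬ G.Adj t v := fun t ht htu h =>
    hQK t (mem_insert_of_mem (mem_erase.2 ⟨htu, mem_nbrF.2 h.symm⟩)) ht
  have hwQ : w ∉ Q := fun h => hQv w h hwu hvw.symm
  have hvP : v ∉ P := fun h => hvw.ne (huP.eq_of_adj h hwP hu.symm huw)
  -- `W` is the edge `{u, v}` followed by an arm `B`.
  obtain ⟨B, hB, hWB, hsep⟩ : ∃ B, G.IsArm u B ∧ W = {u, v} ∪ B ∧ G.SeparatedAt u {u, v} B := by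
    obtain ⟨A, B, hA, hB, hAB, hsep⟩ := (hlam W hW).exists_isArm huW
    rw [hAB, mem_union] at hvW
    rcases hvW with hvA | hvB
    · obtain rfl := hA.eq_pair hu.symm hvA hsimp
      exact ⟨B, hB, hAB, hsep⟩
    · obtain rfl := hB.eq_pair hu.symm hvB hsimp
      exact ⟨A, hA, by rw [hAB, union_comm], hsep.symm⟩
  have hzB : z ∈ B := by
    rw [hWB, mem_union, mem_insert, mem_singleton] at hzW
    exact (hzW.resolve_left (by simp [huz.ne', hvz]))
  have hwz : z ≠ w := by
    rintro rfl
    exact (hsep v (by simp) hu.ne z hzB hwu).2 hvw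
  have hPa : G.IsArm u P := (hlam P hP).isArm huP
  have hBP : G.SeparatedAt u B P := hG.separatedAt hB hPa hzB hwP huz huw hwz hnzw
  obtain ⟨C, D, hC, hD, hCD, hQsep⟩ := (hlam Q hQ).exists_isArm huQ
  have hpair : ∀ X ⊆ Q, G.SeparatedAt u X {u, v} := by
    intro X hX a ha hau b hb hbu
    obtain rfl : b = v := by simpa [hbu] using hb
    exact ⟨fun h => hvQ (h ▸ hX ha), hQv a (hX ha) hau⟩
  have hCp := hpair C (hCD ▸ subset_union_left)
  have hDp := hpair D (hCD ▸ subset_union_right)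
  have huv : G.IsArm u {u, v} := isArm_pair hu.symm
  have hWP : W ≠ P := fun h => hvP (h ▸ hvW)
  have hWQ : W ≠ Q := fun h => hvQ (h ▸ hvW)
  have hPQ : P ≠ Q := fun h => hwQ (h ▸ hwP)
  -- Replace `W`, `P`, `Q` by `B ∪ P`, `C ∪ {u, v}`, `D ∪ {u, v}`.
  let S : Multiset (Finset V) := {W, P, Q}
  let T : Multiset (Finset V) := {B ∪ P, C ∪ {u, v}, D ∪ {u, v}}
  have hS : ∀ X, S.count X ≤ lam X := by
    intro X
    by_cases hX : X ∈ S
    · have hnd : S.Nodup := by simp [S, hWP, hWQ, hPQ]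
      rw [Multiset.count_eq_one_of_mem hnd hX]
      simp only [S, Multiset.insert_eq_cons, Multiset.mem_cons, Multiset.mem_singleton] at hX
      rcases hX with rfl | rfl | rfl <;> omega
    · simp [Multiset.count_eq_zero_of_notMem hX]
  let mu : Finset V → ℕ := fun X => lam X - S.count X + T.count X
  have hmu : ∀ X, mu X ≠ 0 → G.IsInducedPath X := by
    intro X hX
    by_cases hXT : X ∈ T
    · simp only [T, Multiset.insert_eq_cons, Multiset.mem_cons, Multiset.mem_singleton] at hXT
      rcases hXT with rfl | rfl | rfl
      · exact hB.union_isInducedPath hPa hBP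
      · exact hC.union_isInducedPath huv hCp
      · exact hD.union_isInducedPath huv hDp
    · refine hlam X fun h => hX ?_
      simp [mu, h, Multiset.count_eq_zero_of_notMem hXT]
  have hsum : ∑ X : Finset V, (mu X : ℝ) • G.xi X =
      ∑ X : Finset V, (lam X : ℝ) • G.xi X + (G.xi {u, v} - G.xi {u}) := by
    rw [sum_exchange lam S T hS]
    simp only [S, T, Multiset.insert_eq_cons, Multiset.map_cons, Multiset.map_singleton,
      Multiset.sum_cons, Multiset.sum_singleton]
    rw [hWB, hCD, xi_union huv.mem hB.mem hsep, xi_union hC.mem hD.mem hQsep,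
      xi_union hB.mem hPa.mem hBP, xi_union hC.mem huv.mem hCp, xi_union hD.mem huv.mem hDp]
    abel
  have hfst : ∀ x ≠ v, (∑ X : Finset V, (mu X : ℝ) • G.xi X).1 x =
      (∑ X : Finset V, (lam X : ℝ) • G.xi X).1 x := by
    intro x hx
    rw [hsum]
    simp [xi_fst_apply, hx]
  have hsnd : ∀ e, (∑ X : Finset V, (mu X : ℝ) • G.xi X).2 e =
      (∑ X : Finset V, (lam X : ℝ) • G.xi X).2 e + if e = s(u, v) then 1 else 0 := by
    intro e
    rw [hsum, ← xi_pair_snd hu.symm e]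
    simp only [Prod.snd_add, Prod.snd_sub, Pi.add_apply, Pi.sub_apply, xi_singleton_snd, sub_zero]
  have hgap : (∑ X : Finset V, (lam X : ℝ) • G.xi X).2 s(u, v) + 1 ≤ ps.2 s(u, v) := by
    obtain ⟨k, hk⟩ := hinty s(u, v)
    obtain ⟨l, hl⟩ : ∃ l : ℤ, (∑ X : Finset V, (lam X : ℝ) • G.xi X).2 s(u, v) = l := by
      refine ⟨∑ X : Finset V, (lam X : ℤ) * if G.Adj u v ∧ u ∈ X ∧ v ∈ X then 1 else 0, ?_⟩
      rw [sum_smul_xi_snd]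
      push_cast
      simp only [xi_snd_apply]
    rw [hk, hl] at hlt ⊢
    exact_mod_cast hlt
  have hle : ∀ e, (∑ X : Finset V, (mu X : ℝ) • G.xi X).2 e ≤ ps.2 e := by
    intro e
    rw [hsnd]
    split_ifs with h
    · rw [h]
      exact hgap
    · rw [add_zero]
      exact hle2 e
  obtain ⟨nu, hnu, hnu2, hnu1, hnuv⟩ := exists_le_of_edge_le hps hsimp mu hmu hle
  have hnu1' : ∀ x ≠ v, (∑ X : Finset V, (nu X : ℝ) • G.xi X).1 x = ps.1 x := fun x hx => by
    rw [hnu1 x hx, hfst x hx, heq1 x hx]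
  have hfinal := hmin nu _ rfl hnu
    (fun x => by
      by_cases hx : x = v
      · rw [hx]
        exact hnuv
      · exact (hnu1' x hx).le)
    (fun e => hnu2 ▸ hle e) hnu1'
    (fun e he => by
      rw [hnu2, hsnd, if_neg, add_zero, heq2 e he]
      rintro rfl
      exact he (Sym2.mem_mk_right u v))
  refine absurd hfinal (not_le.2 (sum_lt_sum (fun t _ => ?_) ⟨u, mem_nbrF.2 hu, ?_⟩))
  · rw [hnu2, hsnd]
    split_ifs <;> linarith
  · rw [hnu2, hsnd, if_pos rfl]
    linarith
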